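/- (Reflection principle of type B for composite steps.) Let A be an atomic step set that is invariant under the reflection group B_k and such that for every a ∈ A and every u ∈ W⁰ ∩ L one has u + a ∈ W. Let S be a composite step set over A such that for every (a_1,…,a_m) ∈ S, every 1 ≤ j ≤ m and every reflection ρ ∈ B_k, the sequence (ρ(a_1),…,ρ(a_j),a_{j+1},…,a_m) also lies in S, and let w : S → ℝ_{>0} satisfy w((a_1,…,a_m)) = w((ρ(a_1),…,ρ(a_j),a_{j+1},…,a_m)) for all such j and ρ. Then for all u = (u_1,…,u_k) ∈ W⁰ ∩ L, all v ∈ W⁰ ∩ L and all n ≥ 0: P_n^+(u→v) = ∑_{σ ∈ 𝔖_k} ∑_{(ε_1,…,ε_k) ∈ {−1,+1}^k} (∏_{j=1}^k ε_j) · sgn(σ) · P_n((ε_1 u_{σ(1)},…,ε_k u_{σ(k)}) → v), where 𝔖_k is the set of permutations of {1,…,k}. -/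

import Mathlib

open scoped BigOperators
open Classical

noncomputable section

/-- Reflection in the hyperplane `x_i - x_j = 0`: swaps coordinates `i` and `j`. -/
def swapCoord {k : ℕ} (i j : Fin k) : Equiv.Perm (Fin k → ℝ) :=
  Equiv.arrowCongr (Equiv.swap i j) (Equiv.refl ℝ)

/-- Reflection in the hyperplane `x_i = 0`: negates the `i`-th coordinate. -/
def negCoord {k : ℕ} (i : Fin k) : Equiv.Perm (Fin k → ℝ) :=
  Equiv.piCongrRight fun j => if j = i then Equiv.neg ℝ else Equiv.refl ℝ

/-- The reflection group of type `B_k`, generated by the reflections in the hyperplanes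
`x_i - x_j = 0` (`i < j`) and `x_1 = 0`. -/
def BkGroup (k : ℕ) : Subgroup (Equiv.Perm (Fin k → ℝ)) :=
  Subgroup.closure
    ({g | ∃ i j : Fin k, i < j ∧ g = swapCoord i j} ∪
      {g | ∃ h : 0 < k, g = negCoord ⟨0, h⟩})

/-- The open Weyl chamber `0 < x₁ < ⋯ < x_k`. -/
def chamberOpen (k : ℕ) : Set (Fin k → ℝ) :=
  {x | StrictMono x ∧ ∀ j, 0 < x j}

/-- The closed Weyl chamber `0 ≤ x₁ ≤ ⋯ ≤ x_k`. -/
def chamberClosed (k : ℕ) : Set (Fin k → ℝ) :=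
  {x | Monotone x ∧ ∀ j, 0 ≤ x j}

/-- The sequence of atomic steps of a walk with composite steps `f 0, f 1, …`. -/
def walkAtoms {k : ℕ} {S : Finset (List (Fin k → ℝ))} {n : ℕ}
    (f : Fin n → {s // s ∈ S}) : List (Fin k → ℝ) :=
  (List.ofFn fun j => (f j : List (Fin k → ℝ))).flatten

/-- Generating function (weighted count) of `n`-step walks from `u` to `v`. -/
def Pn {k : ℕ} (S : Finset (List (Fin k → ℝ))) (w : List (Fin k → ℝ) → ℝ)
    (n : ℕ) (u v : Fin k → ℝ) : ℝ :=
  ∑ f : Fin n → {s // s ∈ S},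
    if u + ∑ j, (f j : List (Fin k → ℝ)).sum = v then ∏ j, w (f j) else 0

/-- Generating function (weighted count) of `n`-step walks from `u` to `v`, all of whose
intermediate positions (after every atomic step) stay in the open chamber. -/
def PnPlus {k : ℕ} (S : Finset (List (Fin k → ℝ))) (w : List (Fin k → ℝ) → ℝ)
    (n : ℕ) (u v : Fin k → ℝ) : ℝ :=
  ∑ f : Fin n → {s // s ∈ S},
    if (u + ∑ j, (f j : List (Fin k → ℝ)).sum = v) ∧
        ∀ m : ℕ, u + ((walkAtoms f).take m).sum ∈ chamberOpen k
      then ∏ j, w (f j) else 0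

/-! ### The reflection group -/

theorem swapCoord_apply' {k : ℕ} (i j : Fin k) (x : Fin k → ℝ) (l : Fin k) :
    swapCoord i j x l = x (Equiv.swap i j l) := by
  simp [swapCoord, Equiv.arrowCongr]

theorem negCoord_apply' {k : ℕ} (i : Fin k) (x : Fin k → ℝ) (l : Fin k) :
    negCoord i x l = if l = i then - x l else x l := by
  simp only [negCoord, Equiv.piCongrRight_apply, Pi.map_apply]
  split_ifs <;> simp

theorem Bk_add {k : ℕ} {g : Equiv.Perm (Fin k → ℝ)} (hg : g ∈ BkGroup k) :
    ∀ x y, g (x + y) = g x + g y := by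
  induction hg using Subgroup.closure_induction with
  | mem g hg =>
    intro x y
    rcases hg with ⟨i, j, _, rfl⟩ | ⟨h, rfl⟩
    · ext l; simp [swapCoord_apply']
    · ext l
      simp only [negCoord_apply', Pi.add_apply]
      split_ifs <;> ring
  | one => intro x y; rfl
  | mul a b _ _ ha hb => intro x y; simp [Equiv.Perm.mul_apply, ha, hb]
  | inv a _ ha =>
    intro x y
    apply a.injective
    rw [ha]; simp

theorem Bk_zero {k : ℕ} {g : Equiv.Perm (Fin k → ℝ)} (hg : g ∈ BkGroup k) : g 0 = 0 := by
  have := Bk_add hg 0 0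
  simpa using this

theorem Bk_list_sum {k : ℕ} {g : Equiv.Perm (Fin k → ℝ)} (hg : g ∈ BkGroup k)
    (l : List (Fin k → ℝ)) : (l.map g).sum = g l.sum := by
  induction l with
  | nil => simp [Bk_zero hg]
  | cons a l ih => simp [ih, Bk_add hg]

theorem swapCoord_mem {k : ℕ} (i j : Fin k) : swapCoord i j ∈ BkGroup k := by
  rcases lt_trichotomy i j with h | h | h
  · exact Subgroup.subset_closure (Or.inl ⟨i, j, h, rfl⟩)
  · subst h
    have : swapCoord i i = 1 := by
      ext x l; simp [swapCoord_apply']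
    rw [this]; exact Subgroup.one_mem _
  · have : swapCoord i j = swapCoord j i := by
      ext x l; simp [swapCoord_apply', Equiv.swap_comm]
    rw [this]
    exact Subgroup.subset_closure (Or.inl ⟨j, i, h, rfl⟩)

theorem negCoord_mem {k : ℕ} (i : Fin k) : negCoord i ∈ BkGroup k := by
  have h : 0 < k := i.pos
  have h0 : negCoord ⟨0, h⟩ ∈ BkGroup k := Subgroup.subset_closure (Or.inr ⟨h, rfl⟩)
  have : negCoord i = swapCoord ⟨0, h⟩ i * negCoord ⟨0, h⟩ * swapCoord ⟨0, h⟩ i := by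
    ext x l
    simp only [Equiv.Perm.mul_apply, swapCoord_apply', negCoord_apply', Equiv.swap_apply_self]
    have : (Equiv.swap ⟨0, h⟩ i l = ⟨0, h⟩) ↔ l = i := by
      rw [Equiv.swap_apply_eq_iff]; simp
    simp [this]
  rw [this]
  exact Subgroup.mul_mem _ (Subgroup.mul_mem _ (swapCoord_mem _ _) h0) (swapCoord_mem _ _)

theorem exists_perm_mem {k : ℕ} (σ : Equiv.Perm (Fin k)) :
    ∃ g ∈ BkGroup k, ∀ x l, g x l = x (σ l) := by
  induction σ using Equiv.Perm.swap_induction_on with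
  | one => exact ⟨1, Subgroup.one_mem _, fun _ _ => rfl⟩
  | swap_mul f a b _ ih =>
    obtain ⟨g, hg, hgx⟩ := ih
    refine ⟨g * swapCoord a b, Subgroup.mul_mem _ hg (swapCoord_mem _ _), fun x l => ?_⟩
    simp [Equiv.Perm.mul_apply, hgx, swapCoord_apply']

theorem exists_neg_mem {k : ℕ} (s : Finset (Fin k)) :
    ∃ g ∈ BkGroup k, ∀ x l, g x l = if l ∈ s then - x l else x l := by
  induction s using Finset.induction_on with
  | empty => exact ⟨1, Subgroup.one_mem _, fun _ _ => by simp⟩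
  | insert a s has ih =>
    obtain ⟨g, hg, hgx⟩ := ih
    refine ⟨g * negCoord a, Subgroup.mul_mem _ hg (negCoord_mem _), fun x l => ?_⟩
    by_cases hl : l = a
    · subst hl; simp [Equiv.Perm.mul_apply, hgx, negCoord_apply', has]
    · simp [Equiv.Perm.mul_apply, hgx, negCoord_apply', hl]

/-- The signed permutation action. -/
def sgnAct {k : ℕ} (σ : Equiv.Perm (Fin k)) (ε : Fin k → Bool) (x : Fin k → ℝ) : Fin k → ℝ :=
  fun j => (if ε j then (1 : ℝ) else -1) * x (σ j)

/-- The sign of a signed permutation. -/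
def sgnVal {k : ℕ} (σ : Equiv.Perm (Fin k)) (ε : Fin k → Bool) : ℝ :=
  (∏ j, (if ε j then (1 : ℝ) else -1)) * ((Equiv.Perm.sign σ : ℤ) : ℝ)

theorem exists_sgnAct_mem {k : ℕ} (σ : Equiv.Perm (Fin k)) (ε : Fin k → Bool) :
    ∃ g ∈ BkGroup k, ∀ x, g x = sgnAct σ ε x := by
  obtain ⟨g, hg, hgx⟩ := exists_perm_mem σ
  obtain ⟨h, hh, hhx⟩ := exists_neg_mem (Finset.univ.filter fun j => ε j = false)
  refine ⟨h * g, Subgroup.mul_mem _ hh hg, fun x => ?_⟩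
  ext l
  simp only [Equiv.Perm.mul_apply, hhx, hgx, sgnAct, Finset.mem_filter, Finset.mem_univ, true_and]
  cases ε l <;> simp

/-- Antisymmetrization of a function. -/
def antiSum {k : ℕ} (F : (Fin k → ℝ) → ℝ) (x : Fin k → ℝ) : ℝ :=
  ∑ σ : Equiv.Perm (Fin k), ∑ ε : Fin k → Bool, sgnVal σ ε * F (sgnAct σ ε x)

/-- The reflections used for walls. -/
def IsWallReflection {k : ℕ} (g : Equiv.Perm (Fin k → ℝ)) : Prop :=
  (∃ i j, i ≠ j ∧ g = swapCoord i j) ∨ ∃ i, g = negCoord i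

theorem IsWallReflection.mem {k : ℕ} {g : Equiv.Perm (Fin k → ℝ)} (h : IsWallReflection g) : g ∈ BkGroup k := by
  rcases h with ⟨i, j, _, rfl⟩ | ⟨i, rfl⟩
  · exact swapCoord_mem _ _
  · exact negCoord_mem _

theorem IsWallReflection.invol {k : ℕ} {g : Equiv.Perm (Fin k → ℝ)} (h : IsWallReflection g) (x) : g (g x) = x := by
  rcases h with ⟨i, j, _, rfl⟩ | ⟨i, rfl⟩
  · ext l; simp [swapCoord_apply']
  · ext l
    simp only [negCoord_apply']
    split_ifs <;> simp

/-- Antisymmetry under reflections. -/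
def IsAnti {k : ℕ} (G : (Fin k → ℝ) → ℝ) : Prop :=
  ∀ g, IsWallReflection g → ∀ x, G (g x) = - G x

theorem antiSum_isAnti {k : ℕ} (F : (Fin k → ℝ) → ℝ) : IsAnti (antiSum F) := by
  intro g hg x
  rcases hg with ⟨i, j, hij, rfl⟩ | ⟨i, rfl⟩
  · unfold antiSum
    rw [← Finset.sum_neg_distrib]
    refine Fintype.sum_equiv (Equiv.mulLeft (Equiv.swap i j)) _ _ (fun σ => ?_)
    rw [← Finset.sum_neg_distrib]
    refine Finset.sum_congr rfl fun ε _ => ?_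
    have h1 : sgnAct σ ε (swapCoord i j x) = sgnAct (Equiv.mulLeft (Equiv.swap i j) σ) ε x := by
      ext l; simp [sgnAct, swapCoord_apply']
    have h2 : sgnVal (Equiv.mulLeft (Equiv.swap i j) σ) ε = - sgnVal σ ε := by
      simp [sgnVal, Equiv.Perm.sign_swap hij]
    rw [h1, h2]; ring
  · unfold antiSum
    rw [← Finset.sum_neg_distrib]
    refine Finset.sum_congr rfl fun σ _ => ?_
    rw [← Finset.sum_neg_distrib]
    obtain ⟨p, rfl⟩ := σ.surjective i
    have hinv : Function.Involutive
        (fun (ε : Fin k → Bool) => Function.update ε p (!(ε p))) := by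
      intro ε; simp
    refine Fintype.sum_equiv (Function.Involutive.toPerm _ hinv) _ _ (fun ε => ?_)
    have e1 : (Function.Involutive.toPerm _ hinv) ε p = !(ε p) := by simp
    have e2 : ∀ l, l ≠ p → (Function.Involutive.toPerm _ hinv) ε l = ε l := by
      intro l hl; simp [hl]
    generalize (Function.Involutive.toPerm _ hinv) ε = ε' at e1 e2
    have h1 : sgnAct σ ε (negCoord (σ p) x) = sgnAct σ ε' x := by
      ext l
      simp only [sgnAct, negCoord_apply', σ.injective.eq_iff]
      by_cases hl : l = p
      · subst hl
        rw [e1]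
        cases ε l <;> simp
      · rw [e2 l hl]; simp [hl]
    have h2 : sgnVal σ ε' = - sgnVal σ ε := by
      simp only [sgnVal]
      rw [← Finset.mul_prod_erase _ _ (Finset.mem_univ p),
        ← Finset.mul_prod_erase (a := p) _ (fun j => if ε j then (1 : ℝ) else -1)
          (Finset.mem_univ p)]
      have : ∏ x ∈ Finset.univ.erase p, (if ε' x then (1 : ℝ) else -1)
          = ∏ x ∈ Finset.univ.erase p, (if ε x then (1 : ℝ) else -1) := by
        refine Finset.prod_congr rfl fun l hl => ?_
        rw [e2 l (Finset.ne_of_mem_erase hl)]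
      rw [this, e1]
      cases ε p <;> simp
    rw [h1, h2]; ring

theorem antiSum_delta {k : ℕ} {x v : Fin k → ℝ} (hx : x ∈ chamberOpen k)
    (hv : v ∈ chamberOpen k) :
    antiSum (fun y => if y = v then (1 : ℝ) else 0) x = if x = v then 1 else 0 := by
  unfold antiSum
  have key : ∀ σ ε, sgnAct σ ε x = v → σ = 1 ∧ ε = fun _ => true := by
    intro σ ε h
    have hε : ε = fun _ => true := by
      funext j
      by_contra hj
      have hj' : ε j = false := by simpa using hj
      have h1 := congrFun h j
      have h2 := hv.2 j
      have h3 := hx.2 (σ j)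
      simp [sgnAct, hj'] at h1
      linarith
    refine ⟨?_, hε⟩
    subst hε
    have hv' : StrictMono σ := by
      intro a b hab
      have := hv.1 hab
      rw [← h] at this
      simp only [sgnAct, if_true, one_mul] at this
      exact hx.1.lt_iff_lt.1 this
    have := Subsingleton.elim (StrictMono.orderIsoOfSurjective σ hv' σ.surjective)
      (OrderIso.refl (Fin k))
    ext l
    have h3 := congrArg (fun e => (e l : Fin k)) this
    simp at h3
    simp [h3]
  rw [Finset.sum_eq_single (1 : Equiv.Perm (Fin k)), Finset.sum_eq_single (fun _ => true)]
  · have : sgnAct (1 : Equiv.Perm (Fin k)) (fun _ => true) x = x := by ext l; simp [sgnAct]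
    rw [this]
    simp [sgnVal]
  · intro ε _ hε
    simp only [if_neg (fun h => hε (key _ _ h).2), mul_zero]
  · simp
  · intro σ _ hσ
    refine Finset.sum_eq_zero fun ε _ => ?_
    simp only [if_neg (fun h => hσ (key _ _ h).1), mul_zero]
  · simp

/-! ### Walls -/

theorem exists_refl_fix {k : ℕ} {x : Fin k → ℝ} (hx : x ∈ chamberClosed k)
    (hx' : x ∉ chamberOpen k) : ∃ g, IsWallReflection g ∧ g x = x := by
  by_cases hpos : ∀ j, 0 < x j
  · have hinj : ¬ Function.Injective x := fun hi => hx' ⟨hx.1.strictMono_of_injective hi, hpos⟩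
    simp only [Function.Injective, not_forall] at hinj
    obtain ⟨i, j, hij, hne⟩ := hinj
    refine ⟨swapCoord i j, Or.inl ⟨i, j, hne, rfl⟩, ?_⟩
    ext l
    rw [swapCoord_apply']
    by_cases h1 : l = i
    · subst h1; simp [hij]
    · by_cases h2 : l = j
      · subst h2; simp [hij]
      · rw [Equiv.swap_apply_of_ne_of_ne h1 h2]
  · push Not at hpos
    obtain ⟨j, hj⟩ := hpos
    have h0 : x j = 0 := le_antisymm hj (hx.2 j)
    refine ⟨negCoord j, Or.inr ⟨j, rfl⟩, ?_⟩
    ext l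
    rw [negCoord_apply']
    split_ifs with h
    · subst h; simp [h0]
    · rfl

/-- A chosen wall reflection at a point. -/
def wallRefl {k : ℕ} (x : Fin k → ℝ) : Equiv.Perm (Fin k → ℝ) :=
  if h : ∃ g, IsWallReflection g ∧ g x = x then Classical.choose h else 1

theorem wallRefl_mem {k : ℕ} (x : Fin k → ℝ) : wallRefl x ∈ BkGroup k := by
  unfold wallRefl
  split_ifs with h
  · exact (Classical.choose_spec h).1.mem
  · exact Subgroup.one_mem _

theorem wallRefl_invol {k : ℕ} (x y : Fin k → ℝ) : wallRefl x (wallRefl x y) = y := by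
  unfold wallRefl
  split_ifs with h
  · exact (Classical.choose_spec h).1.invol y
  · rfl

theorem wallRefl_spec {k : ℕ} {x : Fin k → ℝ} (hx : x ∈ chamberClosed k)
    (hx' : x ∉ chamberOpen k) : IsWallReflection (wallRefl x) ∧ wallRefl x x = x := by
  have h := exists_refl_fix hx hx'
  unfold wallRefl
  rw [dif_pos h]
  exact Classical.choose_spec h

/-! ### Single composite step -/

/-- The path starting at `x` stays in the open chamber after each step. -/
def goodPath {k : ℕ} : (Fin k → ℝ) → List (Fin k → ℝ) → Prop
  | _, [] => True
  | x, a :: l => x + a ∈ chamberOpen k ∧ goodPath (x + a) l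

/-- Reflect the part of the path after the first exit. -/
def reflPath {k : ℕ} : (Fin k → ℝ) → List (Fin k → ℝ) → List (Fin k → ℝ)
  | _, [] => []
  | x, a :: l => if x + a ∈ chamberOpen k then a :: reflPath (x + a) l
      else a :: l.map (wallRefl (x + a))

theorem reflPath_invol {k : ℕ} (x : Fin k → ℝ) (l : List (Fin k → ℝ)) :
    reflPath x (reflPath x l) = l := by
  induction l generalizing x with
  | nil => rfl
  | cons a l ih =>
    by_cases h : x + a ∈ chamberOpen k
    · simp [reflPath, h, ih]
    · simp [reflPath, h, Function.comp_def, wallRefl_invol]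

theorem goodPath_reflPath {k : ℕ} (x : Fin k → ℝ) (l : List (Fin k → ℝ)) :
    goodPath x (reflPath x l) ↔ goodPath x l := by
  induction l generalizing x with
  | nil => rfl
  | cons a l ih =>
    by_cases h : x + a ∈ chamberOpen k
    · simp [reflPath, goodPath, h, ih]
    · simp [reflPath, goodPath, h]

theorem reflPath_form {k : ℕ} (x : Fin k → ℝ) (l : List (Fin k → ℝ)) :
    ∃ g ∈ BkGroup k, (∀ y, g (g y) = y) ∧ ∃ m ≤ l.length,
      reflPath x l = l.take m ++ (l.drop m).map g := by
  induction l generalizing x with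
  | nil => exact ⟨1, Subgroup.one_mem _, fun _ => rfl, 0, le_refl _, rfl⟩
  | cons a l ih =>
    by_cases h : x + a ∈ chamberOpen k
    · obtain ⟨g, hg, hgg, m, hm, he⟩ := ih (x + a)
      exact ⟨g, hg, hgg, m + 1, by simpa using hm, by simp [reflPath, h, he]⟩
    · exact ⟨wallRefl (x + a), wallRefl_mem _, wallRefl_invol _, 1, by simp, by simp [reflPath, h]⟩

theorem reflPath_mem {k : ℕ} {S : Finset (List (Fin k → ℝ))} {w : List (Fin k → ℝ) → ℝ}
    (hS : ∀ s ∈ S, ∀ g ∈ BkGroup k, ∀ m ≤ s.length,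
      ((s.take m).map (⇑g) ++ s.drop m) ∈ S ∧
        w ((s.take m).map (⇑g) ++ s.drop m) = w s)
    (x : Fin k → ℝ) {s : List (Fin k → ℝ)} (hs : s ∈ S) :
    reflPath x s ∈ S ∧ w (reflPath x s) = w s := by
  obtain ⟨g, hg, hgg, m, hm, he⟩ := reflPath_form x s
  have h1 := hS s hs g hg s.length le_rfl
  simp only [List.take_length, List.drop_length, List.append_nil] at h1
  have h2 := hS _ h1.1 g hg m (by simpa using hm)
  have h3 : (((s.map g).take m).map g ++ (s.map g).drop m) = reflPath x s := by
    rw [he, ← List.map_take, ← List.map_drop, List.map_map]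
    congr 1
    simp [Function.comp_def, hgg]
  rw [h3, h1.2] at h2
  exact h2

theorem anti_reflPath {k : ℕ} {A : Finset (Fin k → ℝ)}
    (hAsmall : ∀ a ∈ A, ∀ x ∈ chamberOpen k,
      x ∈ Submodule.span ℤ (A : Set (Fin k → ℝ)) → x + a ∈ chamberClosed k)
    {G : (Fin k → ℝ) → ℝ} (hG : IsAnti G) (l : List (Fin k → ℝ)) (hl : ∀ a ∈ l, a ∈ A)
    (x : Fin k → ℝ) (hx : x ∈ chamberOpen k)
    (hxL : x ∈ Submodule.span ℤ (A : Set (Fin k → ℝ))) (hb : ¬ goodPath x l) :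
    G (x + (reflPath x l).sum) = - G (x + l.sum) := by
  induction l generalizing x with
  | nil => exact absurd trivial hb
  | cons a l ih =>
    have ha : a ∈ A := hl a (by simp)
    by_cases h : x + a ∈ chamberOpen k
    · have := ih (fun b hb => hl b (by simp [hb])) (x + a) h
        (Submodule.add_mem _ hxL (Submodule.subset_span ha)) (fun hg => hb ⟨h, hg⟩)
      simpa [reflPath, h, add_assoc] using this
    · obtain ⟨hr, hfix⟩ := wallRefl_spec (hAsmall a ha x hx hxL) h
      simp only [reflPath, h, if_false, List.sum_cons, ← add_assoc]
      rw [Bk_list_sum hr.mem]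
      nth_rewrite 1 [← hfix]
      rw [← Bk_add hr.mem, hG _ hr]

theorem goodPath_end {k : ℕ} {A : Finset (Fin k → ℝ)} (l : List (Fin k → ℝ))
    (hl : ∀ a ∈ l, a ∈ A) (x : Fin k → ℝ) (hx : x ∈ chamberOpen k)
    (hxL : x ∈ Submodule.span ℤ (A : Set (Fin k → ℝ))) (hb : goodPath x l) :
    x + l.sum ∈ chamberOpen k ∧ x + l.sum ∈ Submodule.span ℤ (A : Set (Fin k → ℝ)) := by
  induction l generalizing x with
  | nil => simpa using ⟨hx, hxL⟩
  | cons a l ih =>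
    have := ih (fun b hb => hl b (by simp [hb])) (x + a) hb.1
        (Submodule.add_mem _ hxL (Submodule.subset_span (hl a (by simp)))) hb.2
    simpa [add_assoc] using this

/-- Transfer operator. -/
def stepOp {k : ℕ} (S : Finset (List (Fin k → ℝ))) (w : List (Fin k → ℝ) → ℝ)
    (F : (Fin k → ℝ) → ℝ) (x : Fin k → ℝ) : ℝ :=
  ∑ s ∈ S, w s * F (x + s.sum)

/-- Restricted transfer operator. -/
def stepOpPlus {k : ℕ} (S : Finset (List (Fin k → ℝ))) (w : List (Fin k → ℝ) → ℝ)
    (F : (Fin k → ℝ) → ℝ) (x : Fin k → ℝ) : ℝ :=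
  ∑ s ∈ S, if goodPath x s then w s * F (x + s.sum) else 0

theorem stepOp_eq_plus {k : ℕ} {A : Finset (Fin k → ℝ)}
    {S : Finset (List (Fin k → ℝ))} {w : List (Fin k → ℝ) → ℝ}
    (hSA : ∀ s ∈ S, ∀ a ∈ s, a ∈ A)
    (hAsmall : ∀ a ∈ A, ∀ x ∈ chamberOpen k,
      x ∈ Submodule.span ℤ (A : Set (Fin k → ℝ)) → x + a ∈ chamberClosed k)
    (hS : ∀ s ∈ S, ∀ g ∈ BkGroup k, ∀ m ≤ s.length,
      ((s.take m).map (⇑g) ++ s.drop m) ∈ S ∧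
        w ((s.take m).map (⇑g) ++ s.drop m) = w s)
    {G : (Fin k → ℝ) → ℝ} (hG : IsAnti G)
    (x : Fin k → ℝ) (hx : x ∈ chamberOpen k)
    (hxL : x ∈ Submodule.span ℤ (A : Set (Fin k → ℝ))) :
    stepOp S w G x = stepOpPlus S w G x := by
  unfold stepOp stepOpPlus
  rw [← sub_eq_zero, ← Finset.sum_sub_distrib]
  have hcancel : ∀ s ∈ S, (w s * G (x + s.sum) - if goodPath x s then w s * G (x + s.sum) else 0)
      + (w (reflPath x s) * G (x + (reflPath x s).sum) -
        if goodPath x (reflPath x s) then w (reflPath x s) * G (x + (reflPath x s).sum) else 0)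
      = 0 := by
    intro s hs
    rw [goodPath_reflPath]
    split_ifs with h
    · ring
    · rw [anti_reflPath hAsmall hG s (hSA s hs) x hx hxL h, (reflPath_mem hS x hs).2]; ring
  refine Finset.sum_involution (fun s _ => reflPath x s) hcancel ?_
    (fun s hs => (reflPath_mem hS x hs).1) (fun s _ => reflPath_invol x s)
  intro s hs hne heq
  have := hcancel s hs
  rw [heq] at this
  apply hne
  linarith

theorem map_mem {k : ℕ} {S : Finset (List (Fin k → ℝ))} {w : List (Fin k → ℝ) → ℝ}
    (hS : ∀ s ∈ S, ∀ g ∈ BkGroup k, ∀ m ≤ s.length,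
      ((s.take m).map (⇑g) ++ s.drop m) ∈ S ∧
        w ((s.take m).map (⇑g) ++ s.drop m) = w s)
    {g : Equiv.Perm (Fin k → ℝ)} (hg : g ∈ BkGroup k) {s} (hs : s ∈ S) :
    s.map g ∈ S ∧ w (s.map g) = w s := by
  have h1 := hS s hs g hg s.length le_rfl
  simpa only [List.take_length, List.drop_length, List.append_nil] using h1

theorem stepOp_comp {k : ℕ} {S : Finset (List (Fin k → ℝ))} {w : List (Fin k → ℝ) → ℝ}
    (hS : ∀ s ∈ S, ∀ g ∈ BkGroup k, ∀ m ≤ s.length,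
      ((s.take m).map (⇑g) ++ s.drop m) ∈ S ∧
        w ((s.take m).map (⇑g) ++ s.drop m) = w s)
    {g : Equiv.Perm (Fin k → ℝ)} (hg : g ∈ BkGroup k) (F : (Fin k → ℝ) → ℝ) (x : Fin k → ℝ) :
    stepOp S w F (g x) = stepOp S w (fun y => F (g y)) x := by
  unfold stepOp
  symm
  refine Finset.sum_bij' (fun s _ => s.map g) (fun s _ => s.map (g⁻¹ : Equiv.Perm _))
    (fun s hs => (map_mem hS hg hs).1)
    (fun s hs => (map_mem hS (Subgroup.inv_mem _ hg) hs).1) ?_ ?_ ?_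
  · intro s _; simp [Function.comp_def]
  · intro s _; simp [Function.comp_def]
  · intro s hs
    simp only [(map_mem hS hg hs).2, Bk_list_sum hg, Bk_add hg]

theorem stepOp_antiSum {k : ℕ} {S : Finset (List (Fin k → ℝ))} {w : List (Fin k → ℝ) → ℝ}
    (hS : ∀ s ∈ S, ∀ g ∈ BkGroup k, ∀ m ≤ s.length,
      ((s.take m).map (⇑g) ++ s.drop m) ∈ S ∧
        w ((s.take m).map (⇑g) ++ s.drop m) = w s)
    (F : (Fin k → ℝ) → ℝ) :
    stepOp S w (antiSum F) = antiSum (stepOp S w F) := by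
  funext x
  have h : ∀ σ ε, stepOp S w F (sgnAct σ ε x) = ∑ s ∈ S, w s * F (sgnAct σ ε (x + s.sum)) := by
    intro σ ε
    obtain ⟨g, hg, hgx⟩ := exists_sgnAct_mem σ ε
    rw [← hgx, stepOp_comp hS hg]
    simp [stepOp, hgx]
  unfold antiSum
  simp only [h]
  simp only [stepOp, Finset.mul_sum]
  rw [Finset.sum_comm]
  refine Finset.sum_congr rfl fun σ _ => ?_
  rw [Finset.sum_comm]
  refine Finset.sum_congr rfl fun ε _ => Finset.sum_congr rfl fun s _ => ?_
  ring

theorem stepOp_iter_antiSum {k : ℕ} {S : Finset (List (Fin k → ℝ))} {w : List (Fin k → ℝ) → ℝ}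
    (hS : ∀ s ∈ S, ∀ g ∈ BkGroup k, ∀ m ≤ s.length,
      ((s.take m).map (⇑g) ++ s.drop m) ∈ S ∧
        w ((s.take m).map (⇑g) ++ s.drop m) = w s)
    (F : (Fin k → ℝ) → ℝ) (n : ℕ) :
    (stepOp S w)^[n] (antiSum F) = antiSum ((stepOp S w)^[n] F) := by
  induction n with
  | zero => rfl
  | succ n ih => rw [Function.iterate_succ_apply', ih, stepOp_antiSum hS,
      Function.iterate_succ_apply']

/-! ### Walks -/

theorem goodPath_append {k : ℕ} (x : Fin k → ℝ) (l l' : List (Fin k → ℝ)) :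
    goodPath x (l ++ l') ↔ goodPath x l ∧ goodPath (x + l.sum) l' := by
  induction l generalizing x with
  | nil => simp [goodPath]
  | cons a l ih => simp [goodPath, ih, add_assoc, and_assoc]

theorem goodPath_iff {k : ℕ} (x : Fin k → ℝ) (hx : x ∈ chamberOpen k) (l : List (Fin k → ℝ)) :
    (∀ m : ℕ, x + (l.take m).sum ∈ chamberOpen k) ↔ goodPath x l := by
  induction l generalizing x with
  | nil => simpa [goodPath] using hx
  | cons a l ih =>
    constructor
    · intro h
      have h1 : x + a ∈ chamberOpen k := by simpa using h 1
      refine ⟨h1, (ih _ h1).1 fun m => ?_⟩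
      simpa [add_assoc] using h (m + 1)
    · rintro ⟨h1, h2⟩ m
      cases m with
      | zero => simpa using hx
      | succ m => simpa [add_assoc] using (ih _ h1).2 h2 m

theorem Pn_eq_iter {k : ℕ} (S : Finset (List (Fin k → ℝ))) (w : List (Fin k → ℝ) → ℝ)
    (n : ℕ) (u v : Fin k → ℝ) :
    Pn S w n u v = (stepOp S w)^[n] (fun y => if y = v then (1 : ℝ) else 0) u := by
  induction n generalizing u with
  | zero => simp [Pn]
  | succ n ih =>
    rw [Function.iterate_succ_apply']
    unfold stepOp
    rw [← Finset.sum_coe_sort S]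
    unfold Pn
    rw [← (Fin.consEquiv (fun _ => {s // s ∈ S})).sum_comp, Fintype.sum_prod_type]
    refine Finset.sum_congr rfl fun s _ => ?_
    have := ih (u + (s : List (Fin k → ℝ)).sum)
    unfold stepOp at this
    rw [← this, Pn, Finset.mul_sum]
    refine Finset.sum_congr rfl fun f _ => ?_
    simp [Fin.consEquiv, Fin.sum_univ_succ, Fin.prod_univ_succ, add_assoc]

theorem PnPlus_eq_iter {k : ℕ} (S : Finset (List (Fin k → ℝ))) (w : List (Fin k → ℝ) → ℝ)
    (n : ℕ) (u v : Fin k → ℝ) :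
    (∑ f : Fin n → {s // s ∈ S},
      if (u + ∑ j, (f j : List (Fin k → ℝ)).sum = v) ∧ goodPath u (walkAtoms f)
      then ∏ j, w (f j) else 0)
      = (stepOpPlus S w)^[n] (fun y => if y = v then (1 : ℝ) else 0) u := by
  induction n generalizing u with
  | zero => simp [walkAtoms, goodPath]
  | succ n ih =>
    rw [Function.iterate_succ_apply']
    rw [stepOpPlus]
    rw [← Finset.sum_coe_sort S]
    rw [← (Fin.consEquiv (fun _ => {s // s ∈ S})).sum_comp, Fintype.sum_prod_type]
    refine Finset.sum_congr rfl fun s _ => ?_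
    rw [← ih (u + (s : List (Fin k → ℝ)).sum), Finset.mul_sum]
    have hw : ∀ f : Fin n → {s // s ∈ S},
        walkAtoms (Fin.consEquiv (fun _ => {s // s ∈ S}) (s, f)) = s ++ walkAtoms f := by
      intro f
      simp [walkAtoms, Fin.consEquiv, List.ofFn_succ]
    simp only [hw, goodPath_append]
    split_ifs with h
    · refine Finset.sum_congr rfl fun f _ => ?_
      simp [Fin.consEquiv, Fin.sum_univ_succ, Fin.prod_univ_succ, add_assoc, h]
    · refine Finset.sum_eq_zero fun f _ => ?_
      simp [h]


/-- Lemma `lem:reflection_principle`: the reflection principle of type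
`B` for walks with composite steps. -/
theorem reflection_principle_type_B {k : ℕ} (hk : 0 < k)
    (A : Finset (Fin k → ℝ)) (hA0 : (0 : Fin k → ℝ) ∉ A)
    (S : Finset (List (Fin k → ℝ))) (w : List (Fin k → ℝ) → ℝ)
    (hSA : ∀ s ∈ S, ∀ a ∈ s, a ∈ A)
    (hw : ∀ s ∈ S, 0 < w s)
    (hAinv : ∀ a ∈ A, ∀ g ∈ BkGroup k, g a ∈ A)
    (hAsmall : ∀ a ∈ A, ∀ x ∈ chamberOpen k,
      x ∈ Submodule.span ℤ (A : Set (Fin k → ℝ)) → x + a ∈ chamberClosed k)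
    (hS : ∀ s ∈ S, ∀ g ∈ BkGroup k, ∀ m ≤ s.length,
      ((s.take m).map (⇑g) ++ s.drop m) ∈ S ∧
        w ((s.take m).map (⇑g) ++ s.drop m) = w s)
    (u v : Fin k → ℝ)
    (hu : u ∈ chamberOpen k) (huL : u ∈ Submodule.span ℤ (A : Set (Fin k → ℝ)))
    (hv : v ∈ chamberOpen k) (hvL : v ∈ Submodule.span ℤ (A : Set (Fin k → ℝ)))
    (n : ℕ) :
    PnPlus S w n u v =
      ∑ σ : Equiv.Perm (Fin k), ∑ ε : Fin k → Bool,
        (∏ j, (if ε j then (1 : ℝ) else -1)) * ((Equiv.Perm.sign σ : ℤ) : ℝ) *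
          Pn S w n (fun j => (if ε j then (1 : ℝ) else -1) * u (σ j)) v := by
  have hplus : PnPlus S w n u v
      = (stepOpPlus S w)^[n] (fun y => if y = v then (1 : ℝ) else 0) u := by
    rw [← PnPlus_eq_iter]
    unfold PnPlus
    simp only [goodPath_iff u hu]
  have hright : (∑ σ : Equiv.Perm (Fin k), ∑ ε : Fin k → Bool,
        (∏ j, (if ε j then (1 : ℝ) else -1)) * ((Equiv.Perm.sign σ : ℤ) : ℝ) *
          Pn S w n (fun j => (if ε j then (1 : ℝ) else -1) * u (σ j)) v)
      = (stepOp S w)^[n] (antiSum (fun y => if y = v then (1 : ℝ) else 0)) u := by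
    rw [stepOp_iter_antiSum hS]
    simp only [Pn_eq_iter]
    rfl
  rw [hplus, hright]
  clear hplus hright
  induction n generalizing u with
  | zero => exact (antiSum_delta hu hv).symm
  | succ n ih =>
    rw [Function.iterate_succ_apply', Function.iterate_succ_apply']
    have hanti : IsAnti ((stepOp S w)^[n] (antiSum (fun y => if y = v then (1 : ℝ) else 0))) := by
      rw [stepOp_iter_antiSum hS]
      exact antiSum_isAnti _
    rw [stepOp_eq_plus hSA hAsmall hS hanti u hu huL]
    unfold stepOpPlus
    refine Finset.sum_congr rfl fun s hs => ?_
    split_ifs with h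
    · obtain ⟨h1, h2⟩ := goodPath_end s (hSA s hs) u hu huL h
      have := ih (u + s.sum) h1 h2
      unfold stepOpPlus at this
      rw [this]
    · rfl


end
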